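/- Let f₁, f₂ : [a,b] → 𝔽 be g-differentiable at t ∈ [a,b] and suppose f₂(t*)·(f₂(t*) + (f₂)'_g(t)·Δg(t*)) ≠ 0. Then the quotient f₁/f₂ is g-differentiable at t and (f₁/f₂)'_g(t) = [ (f₁)'_g(t) f₂(t*) − (f₂)'_g(t) f₁(t*) ] / [ f₂(t*)·(f₂(t*) + (f₂)'_g(t)·Δg(t*)) ]. -/

import Mathlib

open Set Filter Topology
open scoped Classical

noncomputable section

/-- The right-hand limit `g(t⁺)` of a nondecreasing function `g`. -/
def rLim (g : ℝ → ℝ) (t : ℝ) : ℝ := sInf (g '' Set.Ioi t)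

/-- `Δg(t) = g(t⁺) − g(t)`. -/
def jump (g : ℝ → ℝ) (t : ℝ) : ℝ := rLim g t - g t

/-- `C_g`: the set of points near which `g` is constant. -/
def Cset (g : ℝ → ℝ) : Set ℝ :=
  {t | ∃ ε > 0, ∀ u ∈ Set.Ioo (t - ε) (t + ε), g u = g t}

/-- `D_g`: the set of discontinuity points of `g`. -/
def Dset (g : ℝ → ℝ) : Set ℝ := {t | 0 < jump g t}

/-- The right endpoints `b_n` of the connected components of the open set `C_g`. -/
def rightEndpoints (g : ℝ → ℝ) : Set ℝ :=
  {x | x ∉ Cset g ∧ ∃ s, s < x ∧ Set.Ioo s x ⊆ Cset g}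

/-- The left endpoints `a_n` of the connected components of the open set `C_g`. -/
def leftEndpoints (g : ℝ → ℝ) : Set ℝ :=
  {x | x ∉ Cset g ∧ ∃ s, x < s ∧ Set.Ioo x s ⊆ Cset g}

/-- `N_g⁻ = {a_n : n ∈ Λ} \ D_g`. -/
def Nminus (g : ℝ → ℝ) : Set ℝ := leftEndpoints g \ Dset g

/-- `N_g⁺ = {b_n : n ∈ Λ} \ D_g`. -/
def Nplus (g : ℝ → ℝ) : Set ℝ := rightEndpoints g \ Dset g

/-- `N_g = N_g⁻ ∪ N_g⁺`. -/
def Nset (g : ℝ → ℝ) : Set ℝ := Nminus g ∪ Nplus g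

/-- `t* = t` if `t ∉ C_g`, and `t* = b_n` (the right endpoint of the connected component
`(a_n, b_n)` of `C_g` containing `t`) if `t ∈ C_g`. -/
def tstar (g : ℝ → ℝ) (t : ℝ) : ℝ :=
  if t ∈ Cset g then sSup (connectedComponentIn (Cset g) t) else t

/-- The filter along which the Stieltjes difference quotient is taken at a point of `[a,b]`:
from the right at points of `D_g ∪ N_g⁺ ∪ {a}`, from the left at points of `N_g⁻ ∪ {b}`,
two-sided otherwise. -/
def sFilter (g : ℝ → ℝ) (a b t : ℝ) : Filter ℝ :=
  if t ∈ Dset g ∨ t ∈ Nplus g ∨ t = a then 𝓝[Set.Ioi t ∩ Set.Icc a b] t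
  else if t ∈ Nminus g ∨ t = b then 𝓝[Set.Iio t ∩ Set.Icc a b] t
  else 𝓝[Set.Icc a b \ {t}] t

/-- `f` has Stieltjes derivative (`g`-derivative) `L` at `t`, relative to `[a,b]`. -/
def HasSDerivAt {K : Type*} [RCLike K] (g : ℝ → ℝ) (a b : ℝ) (f : ℝ → K) (t : ℝ) (L : K) :
    Prop :=
  Filter.Tendsto (fun s => (g s - g (tstar g t))⁻¹ • (f s - f (tstar g t)))
    (sFilter g a b (tstar g t)) (𝓝 L)

/-- `f` is `g`-differentiable at `t`, relative to `[a,b]`. -/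
def SDiffAt {K : Type*} [RCLike K] (g : ℝ → ℝ) (a b : ℝ) (f : ℝ → K) (t : ℝ) : Prop :=
  ∃ L, HasSDerivAt g a b f t L

/-- `f` is `g`-continuous at `t` relative to the domain `D`. -/
def GContAt {K : Type*} [RCLike K] (g : ℝ → ℝ) (f : ℝ → K) (D : Set ℝ) (t : ℝ) : Prop :=
  ∀ ε > 0, ∃ δ > 0, ∀ s ∈ D, |g t - g s| < δ → ‖f t - f s‖ < ε

/-- `D₁`: points of `[a,b] ∩ N_g⁻` accumulating `D_g ∩ [a,t)`. -/
def D1 (g : ℝ → ℝ) (a b : ℝ) : Set ℝ :=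
  {x | x ∈ Set.Icc a b ∩ Nminus g ∧ AccPt x (𝓟 (Dset g ∩ Set.Ico a x))}

/-- `D₂`: points of `[a,b] ∩ N_g⁺` accumulating `D_g ∩ (t,b]`. -/
def D2 (g : ℝ → ℝ) (a b : ℝ) : Set ℝ :=
  {x | x ∈ Set.Icc a b ∩ Nplus g ∧ AccPt x (𝓟 (Dset g ∩ Set.Ioc x b))}

/-- `D₃`: points of `[a,b] \ (N_g ∪ D_g)` accumulating `D_g ∩ [a,b]`. -/
def D3 (g : ℝ → ℝ) (a b : ℝ) : Set ℝ :=
  {x | x ∈ Set.Icc a b \ (Nset g ∪ Dset g) ∧ AccPt x (𝓟 (Dset g ∩ Set.Icc a b))}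

/-- `D̃₁`: points of `[a,b] ∩ N_g⁻` not accumulating `D_g ∩ [a,t)`. -/
def Dt1 (g : ℝ → ℝ) (a b : ℝ) : Set ℝ :=
  {x | x ∈ Set.Icc a b ∩ Nminus g ∧ ¬ AccPt x (𝓟 (Dset g ∩ Set.Ico a x))}

/-- `D̃₂`: points of `[a,b] ∩ (N_g⁺ ∪ D_g)` not accumulating `D_g ∩ (t,b]`. -/
def Dt2 (g : ℝ → ℝ) (a b : ℝ) : Set ℝ :=
  {x | x ∈ Set.Icc a b ∩ (Nplus g ∪ Dset g) ∧ ¬ AccPt x (𝓟 (Dset g ∩ Set.Ioc x b))}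

/-- `D̃₃`: points of `[a,b] \ (C_g ∪ N_g ∪ D_g)` not accumulating `D_g ∩ [a,b]`. -/
def Dt3 (g : ℝ → ℝ) (a b : ℝ) : Set ℝ :=
  {x | x ∈ Set.Icc a b \ (Cset g ∪ Nset g ∪ Dset g) ∧ ¬ AccPt x (𝓟 (Dset g ∩ Set.Icc a b))}

/-- `C₁`: points of `[a,b] ∩ N_g⁻` accumulating `C_g ∩ [a,t)`. -/
def C1 (g : ℝ → ℝ) (a b : ℝ) : Set ℝ :=
  {x | x ∈ Set.Icc a b ∩ Nminus g ∧ AccPt x (𝓟 (Cset g ∩ Set.Ico a x))}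

/-- `C₂`: points of `[a,b] ∩ (N_g⁺ ∪ D_g)` accumulating `C_g ∩ (t,b]`. -/
def C2 (g : ℝ → ℝ) (a b : ℝ) : Set ℝ :=
  {x | x ∈ Set.Icc a b ∩ (Nplus g ∪ Dset g) ∧ AccPt x (𝓟 (Cset g ∩ Set.Ioc x b))}

/-- `C₃`: points of `[a,b] \ (C_g ∪ N_g ∪ D_g)` accumulating `C_g ∩ [a,b]`. -/
def C3 (g : ℝ → ℝ) (a b : ℝ) : Set ℝ :=
  {x | x ∈ Set.Icc a b \ (Cset g ∪ Nset g ∪ Dset g) ∧ AccPt x (𝓟 (Cset g ∩ Set.Icc a b))}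

/-- `A_g = {t : sup{s ∈ [a,b] : g(s) = g(t)} ∈ D_g}`. -/
def Ag (g : ℝ → ℝ) (a b : ℝ) : Set ℝ :=
  {t | sSup {s | s ∈ Set.Icc a b ∧ g s = g t} ∈ Dset g}

/-- `H_g`: points lying in some `(s₁, s₂]` with `s₁, s₂ ∈ D_g` and `(s₁, s₂) ⊆ C_g`. -/
def Hg (g : ℝ → ℝ) : Set ℝ :=
  {t | ∃ s₁ ∈ Dset g, ∃ s₂ ∈ Dset g, t ∈ Set.Ioc s₁ s₂ ∧ Set.Ioo s₁ s₂ ⊆ Cset g}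

/-- Membership in `BC_g([a,b], K)`: bounded and `g`-continuous on `[a,b]`. -/
def MemBCg {K : Type*} [RCLike K] (g : ℝ → ℝ) (a b : ℝ) (f : ℝ → K) : Prop :=
  (∃ M, ∀ s ∈ Set.Icc a b, ‖f s‖ ≤ M) ∧ ∀ s ∈ Set.Icc a b, GContAt g f (Set.Icc a b) s

/-- Membership in `BC¹_g([a,b], K)`. -/
def MemBC1g {K : Type*} [RCLike K] (g : ℝ → ℝ) (a b : ℝ) (f : ℝ → K) : Prop :=
  MemBCg g a b f ∧
    ∃ f' : ℝ → K, (∀ s ∈ Set.Icc a b, HasSDerivAt g a b f s (f' s)) ∧ MemBCg g a b f'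

theorem tendsto_rLim {g : ℝ → ℝ} (hg : Monotone g) (x : ℝ) :
    Tendsto g (𝓝[>] x) (𝓝 (rLim g x)) :=
  hg.tendsto_nhdsGT x

theorem jump_nonneg {g : ℝ → ℝ} (hg : Monotone g) (x : ℝ) : 0 ≤ jump g x := by
  have h : g x ≤ rLim g x := ge_of_tendsto (tendsto_rLim hg x)
    (eventually_mem_nhdsWithin.mono fun _ hs => hg (le_of_lt hs))
  exact sub_nonneg.2 h

/-- Along the filter defining the Stieltjes derivative at `x`, the increments of `g` tend to
`Δg(x)`. -/
theorem tendsto_sub_sFilter {g : ℝ → ℝ} (hg : Monotone g)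
    {x : ℝ} (hlc : ContinuousWithinAt g (Set.Iio x) x) (a b : ℝ) :
    Tendsto (fun s => g s - g x) (sFilter g a b x) (𝓝 (jump g x)) := by
  have hright : Tendsto (fun s => g s - g x) (𝓝[>] x) (𝓝 (jump g x)) :=
    (tendsto_rLim hg x).sub_const _
  by_cases hx : x ∈ Dset g ∨ x ∈ Nplus g ∨ x = a
  · rw [sFilter, if_pos hx]
    exact hright.mono_left (nhdsWithin_mono x inter_subset_left)
  · have hjump : jump g x = 0 :=
      le_antisymm (not_lt.1 fun h => hx (Or.inl h)) (jump_nonneg hg x)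
    have hleft : Tendsto (fun s => g s - g x) (𝓝[<] x) (𝓝 (jump g x)) := by
      simpa [hjump] using hlc.tendsto.sub_const (g x)
    rw [sFilter, if_neg hx]
    split_ifs
    · exact hleft.mono_left (nhdsWithin_mono x inter_subset_left)
    · have hne : Tendsto (fun s => g s - g x) (𝓝[≠] x) (𝓝 (jump g x)) := by
        rw [← nhdsLT_sup_nhdsGT]
        exact hleft.sup hright
      exact hne.mono_left (nhdsWithin_mono x fun _ hs => hs.2)

/-- The difference quotient of `u / v`, in terms of the difference quotients of `u` and `v` with
increment `d`. It also holds for `d = 0`, where both sides vanish. -/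
theorem inv_smul_div_sub_div {K : Type*} [RCLike K] {d : ℝ} {u v u₀ v₀ : K} (hv₀ : v₀ ≠ 0)
    (hv : v₀ + d • (d⁻¹ • (v - v₀)) ≠ 0) :
    d⁻¹ • (u / v - u₀ / v₀) = ((d⁻¹ • (u - u₀)) * v₀ - (d⁻¹ • (v - v₀)) * u₀) /
      (v₀ * (v₀ + d • (d⁻¹ • (v - v₀)))) := by
  rcases eq_or_ne d 0 with rfl | hd
  · simp
  · rw [smul_inv_smul₀ hd, add_sub_cancel] at hv ⊢
    simp only [RCLike.real_smul_eq_coe_mul]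
    field_simp
    ring

/-- Quotient rule for Stieltjes derivatives. -/
theorem stmt18 {K : Type*} [RCLike K] (g : ℝ → ℝ) (hg : Monotone g)
    (hlc : ∀ x : ℝ, ContinuousWithinAt g (Set.Iio x) x)
    (a b : ℝ) (hab : a < b) (ha : a ∉ Nminus g)
    (hb : b ∉ Dset g ∪ Cset g ∪ Nplus g)
    (f₁ f₂ : ℝ → K) (t : ℝ) (ht : t ∈ Set.Icc a b) (L₁ L₂ : K)
    (hf₁ : HasSDerivAt g a b f₁ t L₁) (hf₂ : HasSDerivAt g a b f₂ t L₂)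
    (hne : f₂ (tstar g t) * (f₂ (tstar g t) + jump g (tstar g t) • L₂) ≠ 0) :
    HasSDerivAt g a b (fun s => f₁ s / f₂ s) t
      ((L₁ * f₂ (tstar g t) - L₂ * f₁ (tstar g t)) /
        (f₂ (tstar g t) * (f₂ (tstar g t) + jump g (tstar g t) • L₂))) := by
  set x := tstar g t
  have hv₀ : f₂ x ≠ 0 := left_ne_zero_of_mul hne
  have hden : Tendsto
      (fun s => f₂ x + (g s - g x) • ((g s - g x)⁻¹ • (f₂ s - f₂ x)))
      (sFilter g a b x) (𝓝 (f₂ x + jump g x • L₂)) :=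
    ((tendsto_sub_sFilter hg (hlc x) a b).smul hf₂).const_add _
  have hquot := ((hf₁.mul_const (f₂ x)).sub (hf₂.mul_const (f₁ x))).div
    (hden.const_mul (f₂ x)) hne
  refine hquot.congr' ?_
  filter_upwards [hden.eventually_ne (right_ne_zero_of_mul hne)] with s hs
  exact (inv_smul_div_sub_div hv₀ hs).symm
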